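/- arXiv:2209.04201 — 2 statements merged into one kernel-verified Lean document; each statement's English description precedes it below -/
import Mathlib

section
/- Let m ≥ 5 and n ≥ 5 with n odd. The radio number of the stacked-book graph G_{m,n} = S_m □ P_n satisfies rn(G_{m,n}) ≤ (mn² + 2n + m − 2)/2. -/
open SimpleGraph

/-- The star graph on `m` vertices: vertex `0` is the center, adjacent to all others. -/
def starGraph (m : ℕ) : SimpleGraph (Fin m) :=
  SimpleGraph.fromRel (fun a _ => (a : ℕ) = 0)

/-- The stacked-book graph `G_{m,n} = S_m □ P_n`. -/
def stackedBook (m n : ℕ) : SimpleGraph (Fin m × Fin n) :=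
  starGraph m □ SimpleGraph.pathGraph n

/-- A radio labeling of `G`: `|f u - f v| ≥ diam G + 1 - d(u,v)` for all distinct `u, v`. -/
def IsRadioLabeling {V : Type*} (G : SimpleGraph V) (f : V → ℕ) : Prop :=
  ∀ u v : V, u ≠ v → (G.diam : ℤ) + 1 - G.dist u v ≤ |(f u : ℤ) - (f v : ℤ)|

/-- The span of a labeling on a finite vertex set: max label minus min label. -/
noncomputable def labelSpan {V : Type*} [Fintype V] (f : V → ℕ) : ℕ :=
  Finset.univ.sup f - sInf (Set.range f)

/-- The radio number: minimum span over all radio labelings. -/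
noncomputable def radioNumber {V : Type*} [Fintype V] (G : SimpleGraph V) : ℕ :=
  sInf {s | ∃ f : V → ℕ, IsRadioLabeling G f ∧ labelSpan f = s}

namespace Radio

/-- distance in the star -/
def pd (a b : ℕ) : ℕ := if a = b then 0 else if a = 0 ∨ b = 0 then 1 else 2

lemma star_adj {m : ℕ} (a b : Fin m) :
    (_root_.starGraph m).Adj a b ↔ a ≠ b ∧ ((a : ℕ) = 0 ∨ (b : ℕ) = 0) := by
  simp [_root_.starGraph, SimpleGraph.fromRel_adj]

lemma star_connected (q : ℕ) : (_root_.starGraph (q + 1)).Connected := by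
  have : ∀ a : Fin (q + 1), (_root_.starGraph (q + 1)).Reachable 0 a := by
    intro a
    by_cases h : (0 : Fin (q + 1)) = a
    · subst h; exact Reachable.refl _
    · exact Adj.reachable ((star_adj _ _).2 ⟨h, Or.inl rfl⟩)
  exact ⟨fun a b => (this a).symm.trans (this b)⟩

lemma star_dist_lower (q : ℕ) (a b : Fin (q + 1)) :
    pd a b ≤ (_root_.starGraph (q + 1)).dist a b := by
  unfold pd
  split_ifs with h1 h2
  · omega
  · exact (star_connected q).pos_dist_of_ne (fun h => h1 (by rw [h]))
  · refine (star_connected q).one_lt_dist_of_ne_of_not_adj (fun h => h1 (by rw [h])) ?_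
    rw [star_adj]; tauto

lemma star_dist_upper (q : ℕ) (a b : Fin (q + 1)) :
    (_root_.starGraph (q + 1)).dist a b ≤ 2 := by
  have : ∀ a : Fin (q + 1), (_root_.starGraph (q + 1)).dist 0 a ≤ 1 := by
    intro a
    by_cases h : (0 : Fin (q + 1)) = a
    · subst h; simp
    · exact (dist_eq_one_iff_adj.2 ((star_adj _ _).2 ⟨h, Or.inl rfl⟩)).le
  have h := (star_connected q).dist_triangle (u := a) (v := 0) (w := b)
  have h1 := this a
  have h2 := this b
  rw [dist_comm] at h1
  omega

lemma path_walk_lower {n : ℕ} {a b : Fin n} (w : (pathGraph n).Walk a b) :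
    (a : ℕ) ≤ b + w.length ∧ (b : ℕ) ≤ a + w.length := by
  induction w with
  | nil => simp
  | cons h p ih =>
    rw [pathGraph_adj] at h
    simp only [Walk.length_cons]
    omega

lemma path_dist_lower (n : ℕ) (a b : Fin (n + 1)) :
    (a : ℕ) ≤ b + (pathGraph (n + 1)).dist a b ∧ (b : ℕ) ≤ a + (pathGraph (n + 1)).dist a b := by
  obtain ⟨w, hw⟩ := (pathGraph_connected n).exists_walk_length_eq_dist a b
  rw [← hw]
  exact path_walk_lower w

lemma path_dist_upper (n : ℕ) (a b : Fin (n + 1)) : (pathGraph (n + 1)).dist a b ≤ n := by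
  obtain ⟨p, hp, hw⟩ := (pathGraph_connected n).exists_path_of_dist a b
  have := hp.length_lt
  simp at this
  omega

lemma book_connected (q n : ℕ) : (stackedBook (q + 1) (n + 1)).Connected :=
  (star_connected q).boxProd (pathGraph_connected n)

lemma book_dist (q n : ℕ) (u v : Fin (q + 1) × Fin (n + 1)) :
    (stackedBook (q + 1) (n + 1)).dist u v
      = (_root_.starGraph (q + 1)).dist u.1 v.1 + (pathGraph (n + 1)).dist u.2 v.2 := by
  have h := edist_boxProd (G := _root_.starGraph (q + 1)) (H := pathGraph (n + 1)) u v
  rw [← ((star_connected q).preconnected _ _).coe_dist_eq_edist,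
    ← ((pathGraph_connected n).preconnected _ _).coe_dist_eq_edist] at h
  have h2 := ((book_connected q n).preconnected u v).coe_dist_eq_edist
  unfold stackedBook at h2 ⊢
  rw [← h2] at h
  exact_mod_cast h

lemma book_dist_lower (q n : ℕ) (u v : Fin (q + 1) × Fin (n + 1)) :
    (pd u.1 v.1 : ℤ) + |((u.2 : ℕ) : ℤ) - ((v.2 : ℕ) : ℤ)|
      ≤ (stackedBook (q + 1) (n + 1)).dist u v := by
  rw [book_dist]
  have h1 := star_dist_lower q u.1 v.1
  have h2 := path_dist_lower n u.2 v.2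
  have : |((u.2 : ℕ) : ℤ) - ((v.2 : ℕ) : ℤ)| ≤ (pathGraph (n + 1)).dist u.2 v.2 := by
    rw [abs_le]; omega
  push_cast
  omega

lemma book_diam (q n : ℕ) : (stackedBook (q + 1) (n + 1)).diam ≤ n + 2 := by
  obtain ⟨u, v, h⟩ := (stackedBook (q + 1) (n + 1)).exists_dist_eq_diam
  rw [← h, book_dist]
  have := star_dist_upper q u.1 v.1
  have := path_dist_upper n u.2 v.2
  omega

/-! ### The ordering of the vertices -/

/-- `0` on the central page, `1` on the other pages -/
def sE (h i : ℕ) : ℕ := if i = 0 then 0 else if i = 1 then 1 else if i < 4 + 2 * h then 0 else 1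

/-- distance to the middle row -/
def sA (h B : ℕ) (D : ℕ → ℕ) (i : ℕ) : ℕ :=
  if i = 0 then 0 else if i = 1 then h + 1
  else if i < 4 + 2 * h then
    (if i % 2 = 0 then h + 1 - (i - 2) / 2 else (i - 2) / 2 + 1)
  else if i < 4 + 2 * h + 2 * B then
    (if i % 2 = 0 then h - D ((i - (4 + 2 * h)) / 2) else 1 + D ((i - (4 + 2 * h)) / 2))
  else if (i + 1 - (4 + 2 * h + 2 * B)) % 3 = 2 then 0 else h + 1

/-- unreduced page number -/
def sP (h B i : ℕ) : ℕ :=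
  if i = 1 then B
  else if i < 4 + 2 * h + 2 * B then
    (i - (4 + 2 * h)) / 2 + (if i % 2 = 0 then 3 else 1)
  else if (i + 1 - (4 + 2 * h + 2 * B)) % 3 = 2 then B + (i + 1 - (4 + 2 * h + 2 * B)) / 3 + 3
  else if i % 2 = 1 then B + (i + 1 - (4 + 2 * h + 2 * B)) / 3
  else B + (i + 1 - (4 + 2 * h + 2 * B)) / 3 + 1

lemma sE_le (h i : ℕ) : sE h i ≤ 1 := by unfold sE; split_ifs <;> omega

lemma sA_le (h B : ℕ) (D : ℕ → ℕ) (hD : ∀ s < B, D s < h) (i : ℕ) : sA h B D i ≤ h + 1 := by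
  unfold sA
  split_ifs with h1 h2 h3 h4 h5 h6 h7
  all_goals try omega
  have := hD ((i - (4 + 2 * h)) / 2) (by omega)
  omega

lemma sE_small (h i : ℕ) (hi : i < 4 + 2 * h) : sE h i = 0 ∨ sE h (i + 1) = 0 := by
  unfold sE
  split_ifs <;> omega

lemma sP_mid (h B i : ℕ) (hi : 4 + 2 * h ≤ i) (hi2 : i < 4 + 2 * h + 2 * B) :
    sP h B i = (i - (4 + 2 * h)) / 2 + (if i % 2 = 0 then 3 else 1) := by
  unfold sP
  rw [if_neg (by omega), if_pos hi2]

lemma sP_tail (h B i : ℕ) (hi2 : 4 + 2 * h + 2 * B ≤ i) :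
    sP h B i = if (i + 1 - (4 + 2 * h + 2 * B)) % 3 = 2 then
      B + (i + 1 - (4 + 2 * h + 2 * B)) / 3 + 3
      else if i % 2 = 1 then B + (i + 1 - (4 + 2 * h + 2 * B)) / 3
      else B + (i + 1 - (4 + 2 * h + 2 * B)) / 3 + 1 := by
  unfold sP
  rw [if_neg (by omega), if_neg (by omega)]

lemma sP_step1 (h B i : ℕ) : sE h i = 0 ∨ sE h (i + 1) = 0 ∨
    ((sP h B i < sP h B (i + 1) ∧ sP h B (i + 1) ≤ sP h B i + 3) ∨
     (sP h B (i + 1) < sP h B i ∧ sP h B i ≤ sP h B (i + 1) + 3)) := by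
  by_cases hi : i < 4 + 2 * h
  · rcases sE_small h i hi with H | H <;> simp [H]
  right; right
  by_cases h1 : i + 1 < 4 + 2 * h + 2 * B
  · rw [sP_mid h B i (by omega) (by omega), sP_mid h B (i + 1) (by omega) (by omega)]
    split_ifs <;> omega
  by_cases h2 : i < 4 + 2 * h + 2 * B
  · rw [sP_mid h B i (by omega) (by omega), sP_tail h B (i + 1) (by omega)]
    split_ifs <;> omega
  · rw [sP_tail h B i (by omega), sP_tail h B (i + 1) (by omega)]
    obtain ⟨r, rfl⟩ : ∃ r, i = 4 + 2 * h + 2 * B + r := ⟨i - (4 + 2 * h + 2 * B), by omega⟩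
    rw [show 4 + 2 * h + 2 * B + r + 1 - (4 + 2 * h + 2 * B) = r + 1 by omega,
      show 4 + 2 * h + 2 * B + r + 1 + 1 - (4 + 2 * h + 2 * B) = r + 2 by omega]
    split_ifs <;> omega

lemma sP_step2 (h B i : ℕ) : sE h i = 0 ∨ sE h (i + 2) = 0 ∨ (sE h (i + 1) = 0) ∨
    ((sP h B i < sP h B (i + 2) ∧ sP h B (i + 2) ≤ sP h B i + 3) ∨
     (sP h B (i + 2) < sP h B i ∧ sP h B i ≤ sP h B (i + 2) + 3)) := by
  by_cases hi : i < 4 + 2 * h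
  · rcases sE_small h i hi with H | H <;> simp [H]
  right; right; right
  by_cases h1 : i + 2 < 4 + 2 * h + 2 * B
  · rw [sP_mid h B i (by omega) (by omega), sP_mid h B (i + 2) (by omega) (by omega)]
    split_ifs <;> omega
  by_cases h2 : i < 4 + 2 * h + 2 * B
  · rw [sP_mid h B i (by omega) (by omega), sP_tail h B (i + 2) (by omega)]
    split_ifs <;> omega
  · rw [sP_tail h B i (by omega), sP_tail h B (i + 2) (by omega)]
    obtain ⟨r, rfl⟩ : ∃ r, i = 4 + 2 * h + 2 * B + r := ⟨i - (4 + 2 * h + 2 * B), by omega⟩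
    rw [show 4 + 2 * h + 2 * B + r + 1 - (4 + 2 * h + 2 * B) = r + 1 by omega,
      show 4 + 2 * h + 2 * B + r + 2 + 1 - (4 + 2 * h + 2 * B) = r + 3 by omega]
    split_ifs <;> omega

/-- a consecutive pair with small total distance from the middle -/
def light (h B : ℕ) (D : ℕ → ℕ) (i : ℕ) : Prop :=
  sA h B D i + sA h B D (i + 1) ≤ h + 1 ∨
    (sE h i = 0 ∧ sE h (i + 1) = 0 ∧ sA h B D i + sA h B D (i + 1) ≤ h + 2)

lemma light_zero (h B : ℕ) (D : ℕ → ℕ) : light h B D 0 := by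
  left; simp [sA]

lemma light_even (h B : ℕ) (D : ℕ → ℕ) (hD : ∀ s < B, D s < h) (i : ℕ) (h2 : i % 2 = 0)
    (hi : i < 4 + 2 * h + 2 * B) : light h B D i := by
  rcases Nat.eq_zero_or_pos i with rfl | hp
  · exact light_zero h B D
  by_cases hc : i < 4 + 2 * h
  · right
    refine ⟨?_, ?_, ?_⟩
    · unfold sE; split_ifs <;> omega
    · unfold sE; split_ifs <;> omega
    · unfold sA; split_ifs <;> omega
  · left
    have hs : (i + 1 - (4 + 2 * h)) / 2 = (i - (4 + 2 * h)) / 2 := by omega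
    have := hD ((i - (4 + 2 * h)) / 2) (by omega)
    unfold sA
    rw [hs]
    split_ifs <;> omega

lemma light_tail (h B : ℕ) (D : ℕ → ℕ) (i : ℕ) 
    (hi : 4 + 2 * h + 2 * B ≤ i) (h3 : (i + 1 - (4 + 2 * h + 2 * B)) % 3 ≠ 0) :
    light h B D i := by
  left
  unfold sA
  split_ifs <;> omega

lemma light_or (h B : ℕ) (D : ℕ → ℕ) (hD : ∀ s < B, D s < h) (i : ℕ) :
    light h B D i ∨ light h B D (i + 1) := by
  by_cases hi : i + 1 < 4 + 2 * h + 2 * B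
  · rcases Nat.mod_two_eq_zero_or_one i with h2 | h2
    · exact Or.inl (light_even h B D hD i h2 (by omega))
    · exact Or.inr (light_even h B D hD (i + 1) (by omega) hi)
  · by_cases h3 : (i + 1 - (4 + 2 * h + 2 * B)) % 3 = 0
    · exact Or.inr (light_tail h B D (i + 1) (by omega) (by omega))
    · exact Or.inl (light_tail h B D i (by omega) h3)

/-- the labels along the ordering -/
def lab (h B : ℕ) (D : ℕ → ℕ) : ℕ → ℕ
  | 0 => 0
  | i + 1 => lab h B D i +
      (2 * h + 5 - (sE h i + sA h B D i) - (sE h (i + 1) + sA h B D (i + 1)))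

lemma lab_mono (h B : ℕ) (D : ℕ → ℕ) : Monotone (lab h B D) :=
  monotone_nat_of_le_succ fun i => by rw [lab]; omega

/-- the row of the `i`-th vertex -/
def pos (h B : ℕ) (D : ℕ → ℕ) (i : ℕ) : ℕ :=
  if i % 2 = 1 then h + 1 + sA h B D i else h + 1 - sA h B D i

/-- the page of the `i`-th vertex -/
def page (q h B i : ℕ) : ℕ := if sE h i = 0 then 0 else sP h B i % q + 1

lemma mod_ne {q a b : ℕ} (hq : 4 ≤ q) (h : (a < b ∧ b ≤ a + 3) ∨ (b < a ∧ a ≤ b + 3)) :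
    a % q ≠ b % q := by
  have key : ∀ a b : ℕ, a < b ∧ b ≤ a + 3 → a % q ≠ b % q := by
    intro a b hab e
    have := (Nat.modEq_iff_dvd' hab.1.le).1 e
    have := Nat.le_of_dvd (by omega) this
    omega
  rcases h with h | h
  · exact key a b h
  · exact (key b a h).symm

lemma page_cases (q h B i : ℕ) :
    (sE h i = 0 ∧ page q h B i = 0) ∨ (sE h i = 1 ∧ page q h B i = sP h B i % q + 1) := by
  have := sE_le h i
  by_cases hi : sE h i = 0
  · left; simp [page, hi]
  · right; simp [page, hi]; omega

lemma pd_page_ge (q h B i j : ℕ) :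
    sE h i ≤ sE h j + pd (page q h B i) (page q h B j) ∧
    sE h j ≤ sE h i + pd (page q h B i) (page q h B j) := by
  have h1 := page_cases q h B i
  have h2 := page_cases q h B j
  unfold pd
  split_ifs <;> omega

lemma pd_page_eq (q h B i j : ℕ) (hne : sE h i = 0 ∨ sE h j = 0 ∨ sP h B i % q ≠ sP h B j % q) :
    pd (page q h B i) (page q h B j) = sE h i + sE h j := by
  have h1 := page_cases q h B i
  have h2 := page_cases q h B j
  unfold pd
  split_ifs <;> omega

lemma lab_succ (h B : ℕ) (D : ℕ → ℕ) (hD : ∀ s < B, D s < h) (i : ℕ) :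
    lab h B D (i + 1) + (sE h i + sA h B D i) + (sE h (i + 1) + sA h B D (i + 1))
      = lab h B D i + (2 * h + 5) := by
  have e0 := sE_le h i
  have e1 := sE_le h (i + 1)
  have a0 := sA_le h B D hD i
  have a1 := sA_le h B D hD (i + 1)
  rw [lab]
  omega

lemma pos_even (h B : ℕ) (D : ℕ → ℕ) (hD : ∀ s < B, D s < h) (i : ℕ) (hi : i % 2 = 0) :
    (pos h B D i : ℤ) = h + 1 - sA h B D i := by
  have a0 := sA_le h B D hD i
  unfold pos
  rw [if_neg (by omega)]
  omega

lemma pos_odd (h B : ℕ) (D : ℕ → ℕ) (i : ℕ) (hi : i % 2 = 1) :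
    (pos h B D i : ℤ) = h + 1 + sA h B D i := by
  unfold pos
  rw [if_pos (by omega)]
  omega

lemma radio_seq (q h B : ℕ) (D : ℕ → ℕ) (hq : 4 ≤ q) (hD : ∀ s < B, D s < h) (i j : ℕ)
    (hij : i < j) : ((2 * h + 5 : ℕ) : ℤ) ≤ (lab h B D j : ℤ) - lab h B D i +
      (pd (page q h B i) (page q h B j) + |(pos h B D i : ℤ) - (pos h B D j : ℤ)|) := by
  have habs1 := le_abs_self ((pos h B D i : ℤ) - (pos h B D j : ℤ))
  have habs2 := neg_le_abs ((pos h B D i : ℤ) - (pos h B D j : ℤ))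
  have e0 := sE_le h i
  have e1 := sE_le h (i + 1)
  have e2 := sE_le h (i + 2)
  have e3 := sE_le h (i + 3)
  have a0 := sA_le h B D hD i
  have a1 := sA_le h B D hD (i + 1)
  have a2 := sA_le h B D hD (i + 2)
  have l1 := lab_succ h B D hD i
  have l2 := lab_succ h B D hD (i + 1)
  have lt0 := light_or h B D hD i
  unfold light at lt0
  simp only [add_assoc, Nat.reduceAdd] at l1 l2 lt0
  have hpd := pd_page_ge q h B i j
  have hnn := abs_nonneg ((pos h B D i : ℤ) - (pos h B D j : ℤ))
  by_cases h4 : i + 4 ≤ j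
  · have hm := lab_mono h B D h4
    have a3 := sA_le h B D hD (i + 3)
    have a4 := sA_le h B D hD (i + 4)
    have e4 := sE_le h (i + 4)
    have l3 := lab_succ h B D hD (i + 2)
    have l4 := lab_succ h B D hD (i + 3)
    have lt2 := light_or h B D hD (i + 2)
    unfold light at lt2
    simp only [add_assoc, Nat.reduceAdd] at l3 l4 lt2
    generalize |(pos h B D i : ℤ) - (pos h B D j : ℤ)| = z at *
    generalize pd (page q h B i) (page q h B j) = w at *
    clear habs1 habs2 hpd
    have h5 : lab h B D i + (h + 3) ≤ lab h B D (i + 2) := by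
      clear lt2 l3 l4 hm
      omega
    have h6 : lab h B D (i + 2) + (h + 3) ≤ lab h B D (i + 4) := by
      clear lt0 l1 l2 hm
      omega
    omega
  · obtain rfl | rfl | rfl : j = i + 1 ∨ j = i + 2 ∨ j = i + 3 := by omega
    · have hp := pd_page_eq q h B i (i + 1) (by
        rcases sP_step1 h B i with H | H | H
        · exact Or.inl H
        · exact Or.inr (Or.inl H)
        · exact Or.inr (Or.inr (mod_ne hq H)))
      rw [hp]
      clear l2 lt0 hpd
      generalize |(pos h B D i : ℤ) - (pos h B D (i + 1) : ℤ)| = z at *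
      rcases Nat.mod_two_eq_zero_or_one i with h2 | h2
      · rw [pos_even h B D hD i h2, pos_odd h B D (i + 1) (by omega)] at *
        omega
      · rw [pos_odd h B D i h2, pos_even h B D hD (i + 1) (by omega)] at *
        omega
    · have hp : sE h (i + 1) = 0 ∨
          pd (page q h B i) (page q h B (i + 2)) = sE h i + sE h (i + 2) := by
        rcases sP_step2 h B i with H | H | H | H
        · exact Or.inr (pd_page_eq q h B _ _ (Or.inl H))
        · exact Or.inr (pd_page_eq q h B _ _ (Or.inr (Or.inl H)))
        · exact Or.inl H
        · exact Or.inr (pd_page_eq q h B _ _ (Or.inr (Or.inr (mod_ne hq H))))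
      generalize |(pos h B D i : ℤ) - (pos h B D (i + 2) : ℤ)| = z at *
      generalize pd (page q h B i) (page q h B (i + 2)) = w at *
      rcases Nat.mod_two_eq_zero_or_one i with h2 | h2
      · rw [pos_even h B D hD i h2, pos_even h B D hD (i + 2) (by omega)] at *
        rcases lt0 with (lt0 | lt0) | (lt0 | lt0) <;> rcases hp with hp | hp <;> omega
      · rw [pos_odd h B D i h2, pos_odd h B D (i + 2) (by omega)] at *
        rcases lt0 with (lt0 | lt0) | (lt0 | lt0) <;> rcases hp with hp | hp <;> omega
    · have l3 := lab_succ h B D hD (i + 2)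
      simp only [add_assoc, Nat.reduceAdd] at l3
      clear lt0
      generalize |(pos h B D i : ℤ) - (pos h B D (i + 3) : ℤ)| = z at *
      generalize pd (page q h B i) (page q h B (i + 3)) = w at *
      rcases Nat.mod_two_eq_zero_or_one i with h2 | h2
      · rw [pos_even h B D hD i h2, pos_odd h B D (i + 3) (by omega)] at *
        omega
      · rw [pos_odd h B D i h2, pos_even h B D hD (i + 3) (by omega)] at *
        omega

/-! ### Surjectivity of the ordering -/

lemma exists_mod (q c l : ℕ) (hl : l < q) : ∃ t < q, (t + c) % q = l := by
  refine ⟨(l + (q - 1) * c) % q, Nat.mod_lt _ (by omega), ?_⟩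
  rw [Nat.mod_add_mod]
  have : l + (q - 1) * c + c = l + q * c := by
    obtain ⟨r, rfl⟩ : ∃ r, q = r + 1 := ⟨q - 1, by omega⟩
    simp; ring
  rw [this, Nat.add_mul_mod_self_left, Nat.mod_eq_of_lt hl]

lemma mid_even (h B : ℕ) (D : ℕ → ℕ) (s : ℕ) (hs : s < B) :
    sE h (4 + 2 * h + 2 * s) = 1 ∧ sP h B (4 + 2 * h + 2 * s) = s + 3 ∧
    pos h B D (4 + 2 * h + 2 * s) = h + 1 - (h - D s) := by
  refine ⟨?_, ?_, ?_⟩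
  · unfold sE; split_ifs <;> omega
  · unfold sP; split_ifs <;> omega
  · have : (4 + 2 * h + 2 * s - (4 + 2 * h)) / 2 = s := by omega
    unfold pos sA; rw [this]; split_ifs <;> omega

lemma mid_odd (h B : ℕ) (D : ℕ → ℕ) (s : ℕ) (hs : s < B) :
    sE h (4 + 2 * h + 2 * s + 1) = 1 ∧ sP h B (4 + 2 * h + 2 * s + 1) = s + 1 ∧
    pos h B D (4 + 2 * h + 2 * s + 1) = h + 2 + D s := by
  refine ⟨?_, ?_, ?_⟩
  · unfold sE; split_ifs <;> omega
  · unfold sP; split_ifs <;> omega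
  · have : (4 + 2 * h + 2 * s + 1 - (4 + 2 * h)) / 2 = s := by omega
    unfold pos sA
    rw [this, if_pos (by omega), if_neg (by omega), if_neg (by omega), if_neg (by omega),
      if_pos (by omega), if_neg (by omega)]
    omega

lemma tail_zero (h B : ℕ) (D : ℕ → ℕ) (t : ℕ) :
    sE h (5 + 2 * h + 2 * B + 3 * t) = 1 ∧ sP h B (5 + 2 * h + 2 * B + 3 * t) = t + 3 + B ∧
    pos h B D (5 + 2 * h + 2 * B + 3 * t) = h + 1 := by
  refine ⟨?_, ?_, ?_⟩
  · unfold sE; split_ifs <;> omega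
  · unfold sP; split_ifs <;> omega
  · unfold pos sA; split_ifs <;> omega

lemma tail_top (h B : ℕ) (D : ℕ → ℕ) (t : ℕ) :
    ∃ i ≤ 4 + 2 * h + 2 * B + 3 * t, sE h i = 1 ∧ sP h B i = t + B ∧
      pos h B D i = 2 * h + 2 := by
  rcases Nat.eq_zero_or_pos t with rfl | ht
  · exact ⟨1, by omega, by simp [sE], by simp [sP], by simp [pos, sA]; omega⟩
  · rcases Nat.mod_two_eq_zero_or_one t with h2 | h2
    · refine ⟨3 + 2 * h + 2 * B + 3 * t, by omega, ?_, ?_, ?_⟩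
      · unfold sE; split_ifs <;> omega
      · unfold sP; split_ifs <;> omega
      · unfold pos sA; split_ifs <;> omega
    · refine ⟨4 + 2 * h + 2 * B + 3 * t, by omega, ?_, ?_, ?_⟩
      · unfold sE; split_ifs <;> omega
      · unfold sP; split_ifs <;> omega
      · unfold pos sA; split_ifs <;> omega

lemma tail_bot (h B : ℕ) (D : ℕ → ℕ) (t : ℕ) :
    ∃ i ≤ 4 + 2 * h + 2 * B + 3 * t, sE h i = 1 ∧ sP h B i = t + (B + 1) ∧
      pos h B D i = 0 := by
  rcases Nat.mod_two_eq_zero_or_one t with h2 | h2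
  · refine ⟨4 + 2 * h + 2 * B + 3 * t, by omega, ?_, ?_, ?_⟩
    · unfold sE; split_ifs <;> omega
    · unfold sP; split_ifs <;> omega
    · unfold pos sA; split_ifs <;> omega
  · refine ⟨3 + 2 * h + 2 * B + 3 * t, by omega, ?_, ?_, ?_⟩
    · unfold sE; split_ifs <;> omega
    · unfold sP; split_ifs <;> omega
    · unfold pos sA; split_ifs <;> omega

lemma centre_cov (h B : ℕ) (D : ℕ → ℕ) (j : ℕ) (hj : j < 2 * h + 3) :
    ∃ i < 4 + 2 * h, sE h i = 0 ∧ pos h B D i = j := by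
  rcases lt_trichotomy j (h + 1) with hlt | heq | hgt
  · refine ⟨2 + 2 * j, by omega, ?_, ?_⟩
    · unfold sE; split_ifs <;> omega
    · unfold pos sA; split_ifs <;> omega
  · exact ⟨0, by omega, by simp [sE], by simp [pos, sA, heq]⟩
  · refine ⟨3 + 2 * (j - (h + 2)), by omega, ?_, ?_⟩
    · unfold sE; split_ifs <;> omega
    · unfold pos sA; split_ifs <;> omega

lemma cov (q h : ℕ) (hq : 4 ≤ q) (p j : ℕ) (hp : p < q + 1) (hj : j < 2 * h + 3) :
    ∃ i < (q + 1) * (2 * h + 3), page q h (q * h) i = p ∧ pos h (q * h) (fun s => s / q) i = j := by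
  have hN : (q + 1) * (2 * h + 3) = 2 * (q * h) + 3 * q + 2 * h + 3 := by ring
  rw [hN]
  have hmul : ∀ a t, t < q → a < h → q * a + t < q * h := by
    intro a t ht ha
    have : q * (a + 1) ≤ q * h := Nat.mul_le_mul_left q ha
    rw [mul_add] at this
    omega
  have hdiv : ∀ a t, t < q → (q * a + t) / q = a := by
    intro a t ht
    rw [Nat.mul_add_div (by omega), Nat.div_eq_of_lt ht, add_zero]
  have hmod : ∀ a t c, (q * a + t + c) % q = (t + c) % q := by
    intro a t c
    rw [add_assoc, Nat.mul_add_mod]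
  rcases Nat.eq_zero_or_pos p with rfl | hpos
  · obtain ⟨i, hi, h1, h2⟩ := centre_cov h (q * h) (fun s => s / q) j hj
    exact ⟨i, by omega, by simp [page, h1], h2⟩
  obtain ⟨l, rfl⟩ : ∃ l, p = l + 1 := ⟨p - 1, by omega⟩
  have hl : l < q := by omega
  have fin : ∀ i y, sE h i = 1 → sP h (q * h) i = y → y % q = l → page q h (q * h) i = l + 1 := by
    intro i y h1 h2 h3
    simp [page, h1, h2, h3]
  rcases lt_trichotomy j (h + 1) with hlt | heq | hgt
  · rcases Nat.eq_zero_or_pos j with rfl | hj0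
    · obtain ⟨t, ht, htl⟩ := exists_mod q (q * h + 1) l hl
      obtain ⟨i, hi, h1, h2, h3⟩ := tail_bot h (q * h) (fun s => s / q) t
      exact ⟨i, by omega, fin i _ h1 h2 htl, h3⟩
    · obtain ⟨t, ht, htl⟩ := exists_mod q 3 l hl
      have hs := hmul (j - 1) t ht (by omega)
      obtain ⟨h1, h2, h3⟩ := mid_even h (q * h) (fun s => s / q) (q * (j - 1) + t) hs
      refine ⟨_, ?_, fin _ _ h1 h2 ?_, ?_⟩
      · omega
      · rw [hmod, htl]
      · rw [h3]
        simp only [hdiv _ _ ht]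
        omega
  · obtain ⟨t, ht, htl⟩ := exists_mod q (3 + q * h) l hl
    obtain ⟨h1, h2, h3⟩ := tail_zero h (q * h) (fun s => s / q) t
    rw [← add_assoc] at htl
    refine ⟨_, ?_, fin _ _ h1 h2 htl, by omega⟩
    omega
  · by_cases hj2 : j = 2 * h + 2
    · obtain ⟨t, ht, htl⟩ := exists_mod q (q * h) l hl
      obtain ⟨i, hi, h1, h2, h3⟩ := tail_top h (q * h) (fun s => s / q) t
      exact ⟨i, by omega, fin i _ h1 h2 htl, by omega⟩
    · obtain ⟨t, ht, htl⟩ := exists_mod q 1 l hl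
      have hs := hmul (j - (h + 2)) t ht (by omega)
      obtain ⟨h1, h2, h3⟩ := mid_odd h (q * h) (fun s => s / q) (q * (j - (h + 2)) + t) hs
      refine ⟨_, ?_, fin _ _ h1 h2 ?_, ?_⟩
      · omega
      · rw [hmod, htl]
      · rw [h3]
        simp only [hdiv _ _ ht]
        omega

/-! ### The total length -/

lemma lab_sum (h B : ℕ) (D : ℕ → ℕ) (hD : ∀ s < B, D s < h) (j : ℕ) :
    lab h B D j + 2 * ∑ i ∈ Finset.range (j + 1), (sE h i + sA h B D i)
      = j * (2 * h + 5) + (sE h j + sA h B D j) := by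
  induction j with
  | zero => simp [lab, sE, sA]
  | succ j ih =>
    have := lab_succ h B D hD j
    rw [Finset.sum_range_succ, add_mul]
    omega

/-- distance to the central vertex -/
def lev (h p j : ℕ) : ℕ := (if p = 0 then 0 else 1) + ((j - (h + 1)) + (h + 1 - j))

lemma lev_seq (q h B : ℕ) (D : ℕ → ℕ) (hD : ∀ s < B, D s < h) (i : ℕ) :
    lev h (page q h B i) (pos h B D i) = sE h i + sA h B D i := by
  have h1 := page_cases q h B i
  have h2 := sA_le h B D hD i
  unfold lev pos
  split_ifs <;> omega

lemma sum_abs (c : ℕ) : ∑ j ∈ Finset.range (2 * c + 1), ((j - c) + (c - j)) = c * (c + 1) := by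
  have h1 : ∀ c : ℕ, 2 * ∑ j ∈ Finset.range (c + 1), j = c * (c + 1) := by
    intro c
    have := Finset.sum_range_id_mul_two (c + 1)
    simp at this
    linarith
  have h2 : ∑ j ∈ Finset.range (c + 1), ((j - c) + (c - j)) = ∑ j ∈ Finset.range (c + 1), j := by
    rw [← Finset.sum_range_reflect]
    apply Finset.sum_congr rfl
    intro j hj
    rw [Finset.mem_range] at hj
    omega
  have h3 : ∑ j ∈ Finset.range c, ((c + 1 + j - c) + (c - (c + 1 + j)))
      = ∑ j ∈ Finset.range (c + 1), j := by
    rw [Finset.sum_range_succ']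
    simp only [add_zero]
    apply Finset.sum_congr rfl
    intro j hj
    omega
  rw [show 2 * c + 1 = (c + 1) + c by ring, Finset.sum_range_add, h2, h3, ← h1]
  ring

lemma sum_lev (q h : ℕ) :
    ∑ v : Fin (q + 1) × Fin (2 * h + 3), lev h v.1 v.2
      = q * (2 * h + 3) + (q + 1) * ((h + 1) * (h + 2)) := by
  rw [Fintype.sum_prod_type]
  have : ∀ p : ℕ, ∑ j : Fin (2 * h + 3), lev h p j
      = (2 * h + 3) * (if p = 0 then 0 else 1) + (h + 1) * (h + 2) := by
    intro p
    rw [Fin.sum_univ_eq_sum_range (fun j => lev h p j)]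
    unfold lev
    rw [Finset.sum_add_distrib]
    have := sum_abs (h + 1)
    rw [show 2 * (h + 1) + 1 = 2 * h + 3 by ring] at this
    rw [this]
    simp
  simp only [this]
  rw [Finset.sum_add_distrib, Fin.sum_univ_succ]
  simp

end Radio

theorem Radio.main (q h : ℕ) (hq : 4 ≤ q) :
    radioNumber (stackedBook (q + 1) (2 * h + 3)) ≤
      ((q + 1) * (2 * h + 3) ^ 2 + 2 * (2 * h + 3) + (q + 1) - 2) / 2 := by
  classical
  set D : ℕ → ℕ := fun s => s / q with hDdef
  have hD : ∀ s < q * h, D s < h := fun s hs => Nat.div_lt_of_lt_mul hs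
  have hpage : ∀ i, Radio.page q h (q * h) i < q + 1 := by
    intro i
    have := Nat.mod_lt (Radio.sP h (q * h) i) (show 0 < q by omega)
    have := Radio.page_cases q h (q * h) i
    omega
  have hpos : ∀ i, Radio.pos h (q * h) D i < 2 * h + 3 := by
    intro i
    have := Radio.sA_le h (q * h) D hD i
    unfold Radio.pos
    split_ifs <;> omega
  obtain ⟨N, hNdef⟩ : ∃ N, N = (q + 1) * (2 * h + 3) := ⟨_, rfl⟩
  let x : Fin N → Fin (q + 1) × Fin (2 * h + 3) := fun i => (⟨_, hpage i⟩, ⟨_, hpos i⟩)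
  have hsurj : Function.Surjective x := by
    rintro ⟨⟨p, hp⟩, ⟨j, hj⟩⟩
    obtain ⟨i, hi, h1, h2⟩ := Radio.cov q h hq p j hp hj
    refine ⟨⟨i, hNdef ▸ hi⟩, ?_⟩
    simp only [x, Prod.mk.injEq, Fin.mk.injEq]
    exact ⟨h1, h2⟩
  have hbij : Function.Bijective x := by
    refine (Fintype.bijective_iff_surjective_and_card x).2 ⟨hsurj, ?_⟩
    simp [hNdef]
  let idx := Function.surjInv hsurj
  have hidx : ∀ v, x (idx v) = v := Function.surjInv_eq hsurj
  let f : Fin (q + 1) × Fin (2 * h + 3) → ℕ := fun v => Radio.lab h (q * h) D (idx v)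
  have key : ∀ u v, idx u < idx v →
      ((stackedBook (q + 1) (2 * h + 3)).diam : ℤ) + 1
        - (stackedBook (q + 1) (2 * h + 3)).dist u v ≤ (f v : ℤ) - f u := by
    intro u v huv
    have h1 := Radio.radio_seq q h (q * h) D hq hD (idx u) (idx v) huv
    have h2 := Radio.book_dist_lower q (2 * h + 2) u v
    have h3 := Radio.book_diam q (2 * h + 2)
    have hu1 : ((u.1 : Fin (q + 1)) : ℕ) = Radio.page q h (q * h) (idx u) := by
      conv_lhs => rw [← hidx u]
    have hu2 : ((u.2 : Fin (2 * h + 3)) : ℕ) = Radio.pos h (q * h) D (idx u) := by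
      conv_lhs => rw [← hidx u]
    have hv1 : ((v.1 : Fin (q + 1)) : ℕ) = Radio.page q h (q * h) (idx v) := by
      conv_lhs => rw [← hidx v]
    have hv2 : ((v.2 : Fin (2 * h + 3)) : ℕ) = Radio.pos h (q * h) D (idx v) := by
      conv_lhs => rw [← hidx v]
    rw [hu1, hu2, hv1, hv2] at h2
    simp only [f]
    push_cast at h1
    have h3' : ((stackedBook (q + 1) (2 * h + 3)).diam : ℤ) ≤ 2 * h + 2 + 2 := by exact_mod_cast h3
    have h2' := h2.trans_eq (show (((stackedBook (q + 1) (2 * h + 2 + 1)).dist u v : ℕ) : ℤ)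
      = ((stackedBook (q + 1) (2 * h + 3)).dist u v : ℕ) from rfl)
    linarith
  have hradio : IsRadioLabeling (stackedBook (q + 1) (2 * h + 3)) f := by
    intro u v huv
    rcases lt_trichotomy (idx u) (idx v) with hlt | heq | hgt
    · rw [abs_sub_comm]
      exact (key u v hlt).trans (le_abs_self _)
    · exact absurd (by rw [← hidx u, heq, hidx v]) huv
    · rw [SimpleGraph.dist_comm]
      exact (key v u hgt).trans (le_abs_self _)
  have hle : radioNumber (stackedBook (q + 1) (2 * h + 3)) ≤ labelSpan f :=
    Nat.sInf_le ⟨f, hradio, rfl⟩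
  have hNform : N = 2 * (q * h) + 3 * q + 2 * h + 3 := by rw [hNdef]; ring
  have hspan : labelSpan f ≤ Radio.lab h (q * h) D (N - 1) := by
    unfold labelSpan
    refine (Nat.sub_le _ _).trans (Finset.sup_le fun v _ => ?_)
    exact Radio.lab_mono h (q * h) D (by have := (idx v).2; omega)
  refine hle.trans (hspan.trans ?_)
  have hsum := Radio.lab_sum h (q * h) D hD (N - 1)
  have hS : ∑ i ∈ Finset.range N, (Radio.sE h i + Radio.sA h (q * h) D i)
      = q * (2 * h + 3) + (q + 1) * ((h + 1) * (h + 2)) := by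
    rw [← Radio.sum_lev, ← Fin.sum_univ_eq_sum_range
      (fun i => Radio.sE h i + Radio.sA h (q * h) D i)]
    refine Fintype.sum_bijective x hbij _ _ fun i => ?_
    exact (Radio.lev_seq q h (q * h) D hD i).symm
  have hlast : Radio.sE h (N - 1) + Radio.sA h (q * h) D (N - 1) = 1 := by
    have h1 : N - 1 = 5 + 2 * h + 2 * (q * h) + 3 * (q - 1) := by omega
    rw [h1]
    obtain ⟨h2, -, h3⟩ := Radio.tail_zero h (q * h) D (q - 1)
    have h4 := Radio.sA_le h (q * h) D hD (5 + 2 * h + 2 * (q * h) + 3 * (q - 1))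
    unfold Radio.pos at h3
    split_ifs at h3 <;> omega
  rw [show N - 1 + 1 = N by omega, hS, hlast] at hsum
  rw [Nat.le_div_iff_mul_le (by norm_num)]
  have hN1 : N - 1 = 2 * (q * h) + 3 * q + 2 * h + 2 := by omega
  rw [hN1] at hsum ⊢
  apply Nat.le_sub_of_add_le
  nlinarith [hsum]

/-- upper bound `rn(G_{m,n}) ≤ (mn² + 2n + m - 2)/2` for `m ≥ 5`, odd `n ≥ 5`. -/
theorem stmt10 (m n : ℕ) (hm : 5 ≤ m) (hn : 5 ≤ n) (ho : Odd n) :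
    radioNumber (stackedBook m n) ≤ (m * n ^ 2 + 2 * n + m - 2) / 2 := by
  obtain ⟨k, rfl⟩ := ho
  obtain ⟨h, rfl⟩ : ∃ h, k = h + 1 := ⟨k - 1, by omega⟩
  obtain ⟨q, rfl⟩ : ∃ q, m = q + 1 := ⟨m - 1, by omega⟩
  exact Radio.main q h (by omega)
end

section
/- For m, n > 2 with m odd and n even, the radio number of the grid graph P_m □ P_n equals (mn² + nm² − n)/2 − mn − m + 2. -/
open SimpleGraph

/-! ### Distances in paths and grids -/

lemma pathGraph_walk_len {n : ℕ} {u v : Fin n} (p : (pathGraph n).Walk u v) :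
    ((u : ℤ) - (v : ℤ)).natAbs ≤ p.length := by
  induction p with
  | nil => simp
  | cons h p ih =>
    rw [pathGraph_adj] at h
    simp only [Walk.length_cons]
    omega

lemma pathGraph_exists_walk {n : ℕ} (d : ℕ) : ∀ (u v : Fin n), (u : ℕ) + d = v →
    ∃ p : (pathGraph n).Walk u v, p.length = d := by
  induction d with
  | zero =>
    intro u v h
    have : u = v := Fin.ext (by omega)
    subst this
    exact ⟨Walk.nil, rfl⟩
  | succ d ih =>
    intro u v h
    have hv := v.isLt
    let u' : Fin n := ⟨u + 1, by omega⟩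
    obtain ⟨p, hp⟩ := ih u' v (by simp only [u']; omega)
    have ha : (pathGraph n).Adj u u' := by
      rw [pathGraph_adj]; left; rfl
    exact ⟨Walk.cons ha p, by simp [hp]⟩

lemma pathGraph_edist' {n : ℕ} (u v : Fin n) :
    (pathGraph n).edist u v = (((u : ℤ) - (v : ℤ)).natAbs : ℕ∞) := by
  apply le_antisymm
  · rcases le_total (u : ℕ) (v : ℕ) with h | h
    · obtain ⟨p, hp⟩ := pathGraph_exists_walk ((v : ℕ) - u) u v (by omega)
      have := p.edist_le
      rw [hp] at this
      have h2 : ((u : ℤ) - (v : ℤ)).natAbs = (v : ℕ) - u := by omega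
      rw [h2]; exact this
    · obtain ⟨p, hp⟩ := pathGraph_exists_walk ((u : ℕ) - v) v u (by omega)
      have := p.edist_le
      rw [hp, SimpleGraph.edist_comm] at this
      have h2 : ((u : ℤ) - (v : ℤ)).natAbs = (u : ℕ) - v := by omega
      rw [h2]; exact this
  · rw [SimpleGraph.edist]
    refine le_iInf fun p => ?_
    exact_mod_cast pathGraph_walk_len p

/-- The ℓ¹ distance on the grid. -/
def gridDist {m n : ℕ} (u v : Fin m × Fin n) : ℕ :=
  ((u.1 : ℤ) - (v.1 : ℤ)).natAbs + ((u.2 : ℤ) - (v.2 : ℤ)).natAbs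

lemma grid_edist {m n : ℕ} (u v : Fin m × Fin n) :
    (pathGraph m □ pathGraph n).edist u v = (gridDist u v : ℕ∞) := by
  rw [edist_boxProd, pathGraph_edist', pathGraph_edist', gridDist]
  push_cast
  rfl

lemma grid_dist {m n : ℕ} (u v : Fin m × Fin n) :
    (pathGraph m □ pathGraph n).dist u v = gridDist u v := by
  rw [SimpleGraph.dist, grid_edist]
  simp

lemma grid_diam {m n : ℕ} (hm : 0 < m) (hn : 0 < n) :
    (pathGraph m □ pathGraph n).diam = m + n - 2 := by
  have h : (pathGraph m □ pathGraph n).ediam = ((m + n - 2 : ℕ) : ℕ∞) := by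
    apply le_antisymm
    · apply ediam_le_of_edist_le
      intro u v
      rw [grid_edist]
      have h1 := u.1.isLt
      have h2 := u.2.isLt
      have h3 := v.1.isLt
      have h4 := v.2.isLt
      have : gridDist u v ≤ m + n - 2 := by unfold gridDist; omega
      exact_mod_cast this
    · have := edist_le_ediam (G := pathGraph m □ pathGraph n)
        (u := (⟨0, hm⟩, ⟨0, hn⟩)) (v := (⟨m - 1, by omega⟩, ⟨n - 1, by omega⟩))
      rw [grid_edist] at this
      refine le_trans ?_ this
      have h2 : m + n - 2 ≤ gridDist ((⟨0, hm⟩, ⟨0, hn⟩) : Fin m × Fin n)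
          (⟨m - 1, by omega⟩, ⟨n - 1, by omega⟩) := by
        simp only [gridDist]; omega
      exact_mod_cast h2
  rw [SimpleGraph.diam, h]
  exact ENat.toNat_natCast _

/-! ### Weights: doubled distance to the centre -/

/-- Twice the distance to the centre of the grid `P_{2k+1} □ P_{2h}`. -/
def gridW (k h : ℕ) (u : Fin (2 * k + 1) × Fin (2 * h)) : ℤ :=
  2 * |((u.1 : ℕ) : ℤ) - k| + |2 * ((u.2 : ℕ) : ℤ) - (2 * h - 1)|

lemma two_gridDist_le (k h : ℕ) (u v : Fin (2 * k + 1) × Fin (2 * h)) :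
    2 * (gridDist u v : ℤ) ≤ gridW k h u + gridW k h v := by
  simp only [gridDist, gridW, Int.abs_eq_natAbs]
  omega

lemma one_le_gridW (k h : ℕ) (u : Fin (2 * k + 1) × Fin (2 * h)) : 1 ≤ gridW k h u := by
  simp only [gridW, Int.abs_eq_natAbs]
  omega

lemma sum_odd_abs (k : ℕ) :
    ∑ i ∈ Finset.range (2 * k + 1), |((i : ℕ) : ℤ) - k| = k * (k + 1) := by
  induction k with
  | zero => simp
  | succ k ih =>
    rw [show 2 * (k + 1) + 1 = (2 * k + 1) + 1 + 1 by ring, Finset.sum_range_succ,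
      Finset.sum_range_succ']
    have : ∑ i ∈ Finset.range (2 * k + 1), |((i + 1 : ℕ) : ℤ) - ((k + 1 : ℕ) : ℤ)|
        = ∑ i ∈ Finset.range (2 * k + 1), |((i : ℕ) : ℤ) - k| := by
      refine Finset.sum_congr rfl fun i _ => ?_
      congr 1
      push_cast
      ring
    rw [this, ih]
    have h1 : |((0 : ℕ) : ℤ) - ((k + 1 : ℕ) : ℤ)| = k + 1 := by
      rw [Int.abs_eq_natAbs]; omega
    have h2 : |((2 * k + 1 + 1 : ℕ) : ℤ) - ((k + 1 : ℕ) : ℤ)| = k + 1 := by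
      rw [Int.abs_eq_natAbs]; omega
    rw [h1, h2]
    push_cast
    ring

lemma sum_even_abs (h : ℕ) :
    ∑ i ∈ Finset.range (2 * h), |2 * ((i : ℕ) : ℤ) - (2 * h - 1)| = 2 * h * h := by
  induction h with
  | zero => simp
  | succ h ih =>
    rw [show 2 * (h + 1) = (2 * h) + 1 + 1 by ring, Finset.sum_range_succ,
      Finset.sum_range_succ']
    have : ∑ i ∈ Finset.range (2 * h), |2 * ((i + 1 : ℕ) : ℤ) - (2 * ((h + 1 : ℕ) : ℤ) - 1)|
        = ∑ i ∈ Finset.range (2 * h), |2 * ((i : ℕ) : ℤ) - (2 * h - 1)| := by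
      refine Finset.sum_congr rfl fun i _ => ?_
      congr 1
      push_cast
      ring
    rw [this, ih]
    have h1 : |2 * ((0 : ℕ) : ℤ) - (2 * ((h + 1 : ℕ) : ℤ) - 1)| = 2 * h + 1 := by
      rw [Int.abs_eq_natAbs]; omega
    have h2 : |2 * ((2 * h + 1 : ℕ) : ℤ) - (2 * ((h + 1 : ℕ) : ℤ) - 1)| = 2 * h + 1 := by
      rw [Int.abs_eq_natAbs]; omega
    rw [h1, h2]
    push_cast
    ring

lemma sum_gridW (k h : ℕ) :
    ∑ u, gridW k h u = 2 * (2 * h) * (k * (k + 1)) + (2 * k + 1) * (2 * h * h) := by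
  rw [Fintype.sum_prod_type]
  simp only [gridW]
  simp only [Finset.sum_add_distrib, Finset.sum_const, ← Finset.mul_sum, Finset.card_univ,
    Fintype.card_fin, nsmul_eq_mul]
  rw [Fin.sum_univ_eq_sum_range (fun i => |((i : ℕ) : ℤ) - k|) (2 * k + 1),
    Fin.sum_univ_eq_sum_range (fun i => |2 * ((i : ℕ) : ℤ) - (2 * h - 1)|) (2 * h),
    sum_odd_abs, sum_even_abs]
  push_cast
  ring

/-! ### Lower bound -/

lemma lower_aux {V : Type*} [DecidableEq V] (f : V → ℕ) (W : V → ℤ) (M : ℤ)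
    (hf : ∀ u v, u ≠ v → 2 * M - (W u + W v) ≤ 2 * |(f u : ℤ) - (f v : ℤ)|) (s : Finset V) :
    s.Nonempty → ∃ u ∈ s, ∃ v ∈ s, (∀ x ∈ s, f x ≤ f v) ∧
      2 * ((s.card : ℤ) - 1) * M - 2 * ∑ x ∈ s, W x + W u + W v ≤ 2 * ((f v : ℤ) - f u) := by
  induction s using Finset.induction_on_max_value f with
  | empty => intro h; simp at h
  | insert a s ha hmax ih =>
    intro _
    rcases s.eq_empty_or_nonempty with rfl | hs
    · refine ⟨a, by simp, a, by simp, by simp, ?_⟩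
      simp
      linarith
    · obtain ⟨u, hu, v, hv, hv2, hle⟩ := ih hs
      refine ⟨u, Finset.mem_insert_of_mem hu, a, Finset.mem_insert_self a s, ?_, ?_⟩
      · intro x hx
        rcases Finset.mem_insert.mp hx with rfl | hx
        · exact le_rfl
        · exact hmax x hx
      · have h1 := hf a v (by rintro rfl; exact ha hv)
        have h2 : (f v : ℤ) ≤ f a := by exact_mod_cast hmax v hv
        rw [abs_of_nonneg (by linarith)] at h1
        rw [Finset.card_insert_of_notMem ha, Finset.sum_insert ha]
        push_cast
        linarith

lemma lower_bound (k h : ℕ) (hh : 0 < h) (f : Fin (2 * k + 1) × Fin (2 * h) → ℕ)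
    (hf : IsRadioLabeling (pathGraph (2 * k + 1) □ pathGraph (2 * h)) f) :
    ((2 * k + 1) * (2 * h) - 1 : ℤ) * (2 * k + 2 * h)
      - (2 * (2 * h) * (k * (k + 1)) + (2 * k + 1) * (2 * h * h)) + 1 ≤ labelSpan f := by
  have hf' : ∀ u v, u ≠ v → 2 * (2 * k + 2 * h : ℤ) - (gridW k h u + gridW k h v)
      ≤ 2 * |(f u : ℤ) - (f v : ℤ)| := by
    intro u v huv
    have h1 := hf u v huv
    rw [grid_diam (by omega) (by omega), grid_dist] at h1
    have h2 := two_gridDist_le k h u v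
    omega
  have : Nonempty (Fin (2 * k + 1) × Fin (2 * h)) := ⟨(⟨0, by omega⟩, ⟨0, by omega⟩)⟩
  obtain ⟨u, -, v, -, -, hle⟩ := lower_aux f (gridW k h) _ hf' Finset.univ Finset.univ_nonempty
  rw [sum_gridW] at hle
  have h1 := one_le_gridW k h u
  have h2 := one_le_gridW k h v
  have h3 : f v ≤ Finset.univ.sup f := Finset.le_sup (Finset.mem_univ v)
  have h4 : sInf (Set.range f) ≤ f u := Nat.sInf_le ⟨u, rfl⟩
  have h5 : (f v : ℤ) - f u ≤ labelSpan f := by unfold labelSpan; omega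
  simp only [Finset.card_univ, Fintype.card_prod, Fintype.card_fin] at hle
  push_cast at hle
  linarith

/-! ### The optimal ordering -/

/-- Successor in the optimal ordering; `a` is the centred first coordinate, `y` the second one. -/
def gnext (k h : ℤ) (p : ℤ × ℤ) : ℤ × ℤ :=
  if 0 < p.1 then
    if h ≤ p.2 then (p.1 - k - 1, p.2 - h)
    else if p.1 < k then (p.1 - k, p.2 + h)
    else if 0 < p.2 then (-k, p.2 + h - 1)
    else (0, h)
  else if p.1 < 0 then
    if h ≤ p.2 then (p.1 + k + 1, p.2 - h)
    else if -k < p.1 then (p.1 + k, p.2 + h)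
    else if 0 < p.2 then (k, p.2 + h - 1)
    else (0, 2 * h - 1)
  else
    if h ≤ p.2 then (0, p.2 - h - 1)
    else if p.2 = h - 1 then (k, 2 * h - 1)
    else if 0 < p.2 then (0, p.2 + h)
    else (-k, 2 * h - 1)

/-- Position in the optimal ordering. -/
def grank (k h : ℤ) (p : ℤ × ℤ) : ℤ :=
  if 0 < p.1 then
    if h ≤ p.2 then 1 + 2 * (k * (2 * h - 1 - p.2)) + 2 * (k - p.1)
    else 2 * (k * h) + 2 * h - 1 + 2 * (k * (h - 1 - p.2)) + 2 * (p.1 - 1) + 1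
  else if p.1 < 0 then
    if h ≤ p.2 then 2 * (k * h) + 2 * h - 1 + 2 * (k * (2 * h - 1 - p.2)) + 2 * (k + p.1)
    else 1 + 2 * (k * (h - 1 - p.2)) + 2 * (-p.1 - 1) + 1
  else
    if p.2 = h then 4 * (k * h) + 2 * h - 1
    else if h ≤ p.2 then 1 + 2 * (k * h) + 2 * (2 * h - 1 - p.2)
    else if p.2 = h - 1 then 0
    else 1 + 2 * (k * h) + 2 * (h - 2 - p.2) + 1

/-- The grid points in centred coordinates. -/
def GValid (k h : ℤ) (p : ℤ × ℤ) : Prop := -k ≤ p.1 ∧ p.1 ≤ k ∧ 0 ≤ p.2 ∧ p.2 < 2 * h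

/-- ℓ¹ distance on `ℤ × ℤ`. -/
def gd (p q : ℤ × ℤ) : ℕ := (p.1 - q.1).natAbs + (p.2 - q.2).natAbs

set_option maxHeartbeats 4000000 in
lemma gnext_spec (k h a y : ℤ) (hk : 1 ≤ k) (hh : 2 ≤ h) (hv : GValid k h (a, y))
    (hl : ¬ (a = 0 ∧ y = h)) : ∃ a' y', gnext k h (a, y) = (a', y') ∧ ∃ d : ℤ,
    d = gd (a, y) (a', y') ∧ (
    (0 < a ∧ h ≤ y ∧ a' = a - k - 1 ∧ y' = y - h ∧ d = k + 1 + h) ∨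
    (0 < a ∧ a < k ∧ y < h ∧ a' = a - k ∧ y' = y + h ∧ d = k + h) ∨
    (a = k ∧ 0 < y ∧ y < h ∧ a' = -k ∧ y' = y + h - 1 ∧ d = 2 * k + h - 1) ∨
    (a = k ∧ y = 0 ∧ a' = 0 ∧ y' = h ∧ d = k + h) ∨
    (a < 0 ∧ h ≤ y ∧ a' = a + k + 1 ∧ y' = y - h ∧ d = k + 1 + h) ∨
    (a < 0 ∧ -k < a ∧ y < h ∧ a' = a + k ∧ y' = y + h ∧ d = k + h) ∨
    (a = -k ∧ 0 < y ∧ y < h ∧ a' = k ∧ y' = y + h - 1 ∧ d = 2 * k + h - 1) ∨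
    (a = -k ∧ y = 0 ∧ a' = 0 ∧ y' = 2 * h - 1 ∧ d = k + 2 * h - 1) ∨
    (a = 0 ∧ h < y ∧ a' = 0 ∧ y' = y - h - 1 ∧ d = h + 1) ∨
    (a = 0 ∧ y = h - 1 ∧ a' = k ∧ y' = 2 * h - 1 ∧ d = k + h) ∨
    (a = 0 ∧ 0 < y ∧ y < h - 1 ∧ a' = 0 ∧ y' = y + h ∧ d = h) ∨
    (a = 0 ∧ y = 0 ∧ a' = -k ∧ y' = 2 * h - 1 ∧ d = k + 2 * h - 1)) := by
  obtain ⟨h1, h2, h3, h4⟩ := hv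
  simp only at h1 h2 h3 h4
  simp only [gnext, gd]
  split_ifs <;> refine ⟨_, _, rfl, _, rfl, ?_⟩
  · exact Or.inl ⟨by omega, by omega, by omega, by omega, by omega⟩
  · exact Or.inr <| Or.inl ⟨by omega, by omega, by omega, by omega, by omega, by omega⟩
  · exact Or.inr <| Or.inr <| Or.inl ⟨by omega, by omega, by omega, by omega, by omega, by omega⟩
  · exact Or.inr <| Or.inr <| Or.inr <| Or.inl ⟨by omega, by omega, by omega, by omega, by omega⟩
  · exact Or.inr <| Or.inr <| Or.inr <| Or.inr <| Or.inl 
      ⟨by omega, by omega, by omega, by omega, by omega⟩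
  · exact Or.inr <| Or.inr <| Or.inr <| Or.inr <| Or.inr <| Or.inl 
      ⟨by omega, by omega, by omega, by omega, by omega, by omega⟩
  · exact Or.inr <| Or.inr <| Or.inr <| Or.inr <| Or.inr <| Or.inr <| Or.inl 
      ⟨by omega, by omega, by omega, by omega, by omega, by omega⟩
  · exact Or.inr <| Or.inr <| Or.inr <| Or.inr <| Or.inr <| Or.inr <| Or.inr <| Or.inl 
      ⟨by omega, by omega, by omega, by omega, by omega⟩
  · exact Or.inr <| Or.inr <| Or.inr <| Or.inr <| Or.inr <| Or.inr <| Or.inr <| Or.inr <| Or.inl 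
      ⟨by omega, by omega, by omega, by omega, by omega⟩
  · exact Or.inr <| Or.inr <| Or.inr <| Or.inr <| Or.inr <| Or.inr <| Or.inr <| Or.inr <| Or.inr <| Or.inl 
      ⟨by omega, by omega, by omega, by omega, by omega⟩
  · exact Or.inr <| Or.inr <| Or.inr <| Or.inr <| Or.inr <| Or.inr <| Or.inr <| Or.inr <| Or.inr <| Or.inr <| Or.inl 
      ⟨by omega, by omega, by omega, by omega, by omega, by omega⟩
  · exact Or.inr <| Or.inr <| Or.inr <| Or.inr <| Or.inr <| Or.inr <| Or.inr <| Or.inr <| Or.inr <| Or.inr <| Or.inr <| 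
      ⟨by omega, by omega, by omega, by omega, by omega⟩

set_option maxHeartbeats 4000000 in
lemma gnext_valid (k h : ℤ) (p : ℤ × ℤ) (hk : 1 ≤ k) (hh : 2 ≤ h) (hv : GValid k h p)
    (hl : p ≠ (0, h)) : GValid k h (gnext k h p) := by
  obtain ⟨a, y⟩ := p
  obtain ⟨a', y', e, d, hd, hc⟩ := gnext_spec k h a y hk hh hv (by simpa using hl)
  rw [e]
  obtain ⟨h1, h2, h3, h4⟩ := hv
  simp only at h1 h2 h3 h4
  simp only [GValid]
  clear hd e
  omega

set_option maxHeartbeats 4000000 in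
lemma gnext_rank (k h : ℤ) (p : ℤ × ℤ) (hk : 1 ≤ k) (hh : 2 ≤ h) (hv : GValid k h p)
    (hl : p ≠ (0, h)) : grank k h (gnext k h p) = grank k h p + 1 := by
  obtain ⟨a, y⟩ := p
  obtain ⟨a', y', e, d, hd, hc⟩ := gnext_spec k h a y hk hh hv (by simpa using hl)
  rw [e]
  obtain ⟨h1, h2, h3, h4⟩ := hv
  simp only at h1 h2 h3 h4
  clear hd e
  simp only [grank]
  rcases hc with ⟨g1, g2, rfl, rfl, -⟩ | ⟨g1, g2, g3, rfl, rfl, -⟩ | ⟨rfl, g2, g3, rfl, rfl, -⟩ |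
    ⟨rfl, rfl, rfl, rfl, -⟩ | ⟨g1, g2, rfl, rfl, -⟩ | ⟨g1, g2, g3, rfl, rfl, -⟩ |
    ⟨rfl, g2, g3, rfl, rfl, -⟩ | ⟨rfl, rfl, rfl, rfl, -⟩ | ⟨rfl, g2, rfl, rfl, -⟩ |
    ⟨rfl, rfl, rfl, rfl, -⟩ | ⟨rfl, g2, g3, rfl, rfl, -⟩ | ⟨rfl, rfl, rfl, rfl, -⟩ <;>
  · split_ifs <;> first
      | (exfalso; omega)
      | ring1

set_option maxHeartbeats 4000000 in
lemma gnext_W (k h : ℤ) (p : ℤ × ℤ) (hk : 1 ≤ k) (hh : 2 ≤ h) (hv : GValid k h p)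
    (hl : p ≠ (0, h)) : 2 * (gd p (gnext k h p) : ℤ) =
      (2 * |p.1| + |2 * p.2 - (2 * h - 1)|) +
      (2 * |(gnext k h p).1| + |2 * (gnext k h p).2 - (2 * h - 1)|) := by
  obtain ⟨a, y⟩ := p
  obtain ⟨a', y', e, d, hd, hc⟩ := gnext_spec k h a y hk hh hv (by simpa using hl)
  rw [e, ← hd]
  obtain ⟨h1, h2, h3, h4⟩ := hv
  simp only at h1 h2 h3 h4
  clear hd e
  simp only [Int.abs_eq_natAbs]
  rcases hc with hc | hc | hc | hc | hc | hc | hc | hc | hc | hc | hc | hc <;> omega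

set_option maxHeartbeats 4000000 in
lemma gap_pos (k h : ℤ) (p : ℤ × ℤ) (hk : 1 ≤ k) (hh : 2 ≤ h) (hv : GValid k h p)
    (hl : p ≠ (0, h)) : 1 ≤ 2 * k + 2 * h - gd p (gnext k h p) := by
  obtain ⟨a, y⟩ := p
  obtain ⟨a', y', e, d, hd, hc⟩ := gnext_spec k h a y hk hh hv (by simpa using hl)
  rw [e, ← hd]
  clear hd e
  omega

set_option maxHeartbeats 4000000 in
lemma gap_two (k h : ℤ) (p : ℤ × ℤ) (hk : 1 ≤ k) (hh : 2 ≤ h) (hv : GValid k h p)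
    (hl : p ≠ (0, h)) (hl2 : gnext k h p ≠ (0, h)) :
    2 * k + 2 * h - gd p (gnext k h (gnext k h p)) ≤
      (2 * k + 2 * h - gd p (gnext k h p)) +
      (2 * k + 2 * h - gd (gnext k h p) (gnext k h (gnext k h p))) := by
  have hv2 := gnext_valid k h p hk hh hv hl
  obtain ⟨a, y⟩ := p
  obtain ⟨a', y', e, d, hd, hc⟩ := gnext_spec k h a y hk hh hv (by simpa using hl)
  rw [e] at hl2 hv2 ⊢
  obtain ⟨a2, y2, e2, d2, hd2, hc2⟩ := gnext_spec k h a' y' hk hh hv2 (by simpa using hl2)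
  rw [e2, ← hd, ← hd2]
  obtain ⟨h1, h2, h3, h4⟩ := hv
  simp only at h1 h2 h3 h4
  clear hd hd2 e e2 hv2 hl hl2
  have q1 : (a - a2) + (y - y2) ≤ gd (a, y) (a2, y2) := by simp only [gd]; omega
  have q2 : (a - a2) - (y - y2) ≤ gd (a, y) (a2, y2) := by simp only [gd]; omega
  have q3 : -(a - a2) + (y - y2) ≤ gd (a, y) (a2, y2) := by simp only [gd]; omega
  have q4 : -(a - a2) - (y - y2) ≤ gd (a, y) (a2, y2) := by simp only [gd]; omega
  generalize gd (a, y) (a2, y2) = D at *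
  rcases hc with ⟨g1, g2, rfl, rfl, rfl⟩ | ⟨g1, g2, g3, rfl, rfl, rfl⟩ | ⟨g1, g2, g3, rfl, rfl, rfl⟩ |
    ⟨g1, g2, rfl, rfl, rfl⟩ | ⟨g1, g2, rfl, rfl, rfl⟩ | ⟨g1, g2, g3, rfl, rfl, rfl⟩ |
    ⟨g1, g2, g3, rfl, rfl, rfl⟩ | ⟨g1, g2, rfl, rfl, rfl⟩ | ⟨g1, g2, rfl, rfl, rfl⟩ |
    ⟨g1, g2, rfl, rfl, rfl⟩ | ⟨g1, g2, g3, rfl, rfl, rfl⟩ | ⟨g1, g2, rfl, rfl, rfl⟩ <;>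
  rcases hc2 with ⟨f1, f2, rfl, rfl, rfl⟩ | ⟨f1, f2, f3, rfl, rfl, rfl⟩ | ⟨f1, f2, f3, rfl, rfl, rfl⟩ |
    ⟨f1, f2, rfl, rfl, rfl⟩ | ⟨f1, f2, rfl, rfl, rfl⟩ | ⟨f1, f2, f3, rfl, rfl, rfl⟩ |
    ⟨f1, f2, f3, rfl, rfl, rfl⟩ | ⟨f1, f2, rfl, rfl, rfl⟩ | ⟨f1, f2, rfl, rfl, rfl⟩ |
    ⟨f1, f2, rfl, rfl, rfl⟩ | ⟨f1, f2, f3, rfl, rfl, rfl⟩ | ⟨f1, f2, rfl, rfl, rfl⟩ <;>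
  omega

set_option maxHeartbeats 4000000 in
lemma gap_three (k h : ℤ) (p : ℤ × ℤ) (hk : 1 ≤ k) (hh : 2 ≤ h) (hv : GValid k h p)
    (hl : p ≠ (0, h)) (hl2 : gnext k h p ≠ (0, h)) (hl3 : gnext k h (gnext k h p) ≠ (0, h)) :
    2 * k + 2 * h - 1 ≤
      (2 * k + 2 * h - gd p (gnext k h p)) +
      (2 * k + 2 * h - gd (gnext k h p) (gnext k h (gnext k h p))) +
      (2 * k + 2 * h - gd (gnext k h (gnext k h p)) (gnext k h (gnext k h (gnext k h p)))) := by
  have hv2 := gnext_valid k h p hk hh hv hl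
  have hv3 := gnext_valid k h _ hk hh hv2 hl2
  obtain ⟨a, y⟩ := p
  obtain ⟨a', y', e, d, hd, hc⟩ := gnext_spec k h a y hk hh hv (by simpa using hl)
  rw [e] at hl2 hl3 hv2 hv3 ⊢
  obtain ⟨a2, y2, e2, d2, hd2, hc2⟩ := gnext_spec k h a' y' hk hh hv2 (by simpa using hl2)
  rw [e2] at hl3 hv3 ⊢
  obtain ⟨a3, y3, e3, d3, hd3, hc3⟩ := gnext_spec k h a2 y2 hk hh hv3 (by simpa using hl3)
  rw [e3, ← hd, ← hd2, ← hd3]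
  obtain ⟨h1, h2, h3, h4⟩ := hv
  simp only at h1 h2 h3 h4
  clear hd hd2 hd3 e e2 e3 hv2 hv3 hl hl2 hl3
  rcases hc with ⟨g1, g2, rfl, rfl, rfl⟩ | ⟨g1, g2, g3, rfl, rfl, rfl⟩ | ⟨g1, g2, g3, rfl, rfl, rfl⟩ |
    ⟨g1, g2, rfl, rfl, rfl⟩ | ⟨g1, g2, rfl, rfl, rfl⟩ | ⟨g1, g2, g3, rfl, rfl, rfl⟩ |
    ⟨g1, g2, g3, rfl, rfl, rfl⟩ | ⟨g1, g2, rfl, rfl, rfl⟩ | ⟨g1, g2, rfl, rfl, rfl⟩ |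
    ⟨g1, g2, rfl, rfl, rfl⟩ | ⟨g1, g2, g3, rfl, rfl, rfl⟩ | ⟨g1, g2, rfl, rfl, rfl⟩ <;>
  rcases hc2 with ⟨f1, f2, rfl, rfl, rfl⟩ | ⟨f1, f2, f3, rfl, rfl, rfl⟩ | ⟨f1, f2, f3, rfl, rfl, rfl⟩ |
    ⟨f1, f2, rfl, rfl, rfl⟩ | ⟨f1, f2, rfl, rfl, rfl⟩ | ⟨f1, f2, f3, rfl, rfl, rfl⟩ |
    ⟨f1, f2, f3, rfl, rfl, rfl⟩ | ⟨f1, f2, rfl, rfl, rfl⟩ | ⟨f1, f2, rfl, rfl, rfl⟩ |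
    ⟨f1, f2, rfl, rfl, rfl⟩ | ⟨f1, f2, f3, rfl, rfl, rfl⟩ | ⟨f1, f2, rfl, rfl, rfl⟩ <;>
  first
  | (exfalso; clear hc3; omega)
  | (rcases hc3 with ⟨e1, e2, rfl, rfl, rfl⟩ | ⟨e1, e2, e3, rfl, rfl, rfl⟩ | ⟨e1, e2, e3, rfl, rfl, rfl⟩ |
        ⟨e1, e2, rfl, rfl, rfl⟩ | ⟨e1, e2, rfl, rfl, rfl⟩ | ⟨e1, e2, e3, rfl, rfl, rfl⟩ |
        ⟨e1, e2, e3, rfl, rfl, rfl⟩ | ⟨e1, e2, rfl, rfl, rfl⟩ | ⟨e1, e2, rfl, rfl, rfl⟩ |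
        ⟨e1, e2, rfl, rfl, rfl⟩ | ⟨e1, e2, e3, rfl, rfl, rfl⟩ | ⟨e1, e2, rfl, rfl, rfl⟩ <;>
      omega)

/-! ### Upper bound -/

/-- The optimal ordering. -/
def gseq (k h : ℕ) (i : ℕ) : ℤ × ℤ := (gnext k h)^[i] (0, (h : ℤ) - 1)

lemma gseq_succ (k h i : ℕ) : gseq k h (i + 1) = gnext k h (gseq k h i) := by
  simp only [gseq, Function.iterate_succ_apply']

lemma grank_last (k h : ℤ) : grank k h (0, h) = 4 * (k * h) + 2 * h - 1 := by
  simp [grank]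

lemma gseq_ne_last (k h i : ℕ) (hi : i + 1 < (2 * k + 1) * (2 * h))
    (hr : grank k h (gseq k h i) = i) : gseq k h i ≠ (0, (h : ℤ)) := by
  intro he
  rw [he, grank_last] at hr
  zify at hi
  linarith

lemma gseq_spec (k h : ℕ) (hk : 1 ≤ k) (hh : 2 ≤ h) (i : ℕ) :
    i < (2 * k + 1) * (2 * h) → GValid k h (gseq k h i) ∧ grank k h (gseq k h i) = i := by
  induction i with
  | zero =>
    intro _
    simp only [gseq, Function.iterate_zero, id_eq, GValid, grank]
    refine ⟨⟨by omega, by omega, by omega, by omega⟩, ?_⟩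
    simp
  | succ i ih =>
    intro hi
    obtain ⟨h1, h2⟩ := ih (by omega)
    have h3 := gseq_ne_last k h i hi h2
    rw [gseq_succ]
    refine ⟨gnext_valid _ _ _ (by omega) (by omega) h1 h3, ?_⟩
    rw [gnext_rank _ _ _ (by omega) (by omega) h1 h3, h2]
    push_cast
    rfl

/-- Centred coordinates of a vertex. -/
def gcoord (k h : ℕ) (u : Fin (2 * k + 1) × Fin (2 * h)) : ℤ × ℤ :=
  (((u.1 : ℕ) : ℤ) - k, ((u.2 : ℕ) : ℤ))

lemma gd_gcoord (k h : ℕ) (u v : Fin (2 * k + 1) × Fin (2 * h)) :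
    gd (gcoord k h u) (gcoord k h v) = gridDist u v := by
  simp only [gd, gcoord, gridDist]
  omega

lemma gcoord_surj (k h : ℕ) (p : ℤ × ℤ) (hp : GValid k h p) : ∃ u, gcoord k h u = p := by
  obtain ⟨a, y⟩ := p
  obtain ⟨h1, h2, h3, h4⟩ := hp
  simp only at h1 h2 h3 h4
  refine ⟨(⟨(a + k).toNat, by omega⟩, ⟨y.toNat, by omega⟩), ?_⟩
  simp only [gcoord, Prod.mk.injEq]
  omega

lemma exists_order (k h : ℕ) (hk : 1 ≤ k) (hh : 2 ≤ h) :
    ∃ σ : Fin ((2 * k + 1) * (2 * h)) ≃ Fin (2 * k + 1) × Fin (2 * h),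
      ∀ i, gcoord k h (σ i) = gseq k h i := by
  have h1 : ∀ i : Fin ((2 * k + 1) * (2 * h)), ∃ u, gcoord k h u = gseq k h i :=
    fun i => gcoord_surj k h _ (gseq_spec k h hk hh i i.isLt).1
  choose σ hσ using h1
  have hinj : Function.Injective σ := by
    intro i j hij
    have h2 : gseq k h i = gseq k h j := by rw [← hσ, ← hσ, hij]
    have h3 := (gseq_spec k h hk hh i i.isLt).2
    have h4 := (gseq_spec k h hk hh j j.isLt).2
    rw [h2] at h3
    apply Fin.ext
    exact_mod_cast h3.symm.trans h4
  have hbij : Function.Bijective σ :=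
    (Fintype.bijective_iff_injective_and_card σ).2 ⟨hinj, by simp⟩
  exact ⟨Equiv.ofBijective σ hbij, hσ⟩

/-- Gaps between consecutive labels. -/
def ggap (k h i : ℕ) : ℕ := 2 * k + 2 * h - gd (gseq k h i) (gseq k h (i + 1))

/-- Labels along the ordering. -/
def glabel (k h i : ℕ) : ℕ := ∑ j ∈ Finset.range i, ggap k h j

lemma glabel_succ (k h i : ℕ) : glabel k h (i + 1) = glabel k h i + ggap k h i :=
  Finset.sum_range_succ _ _

lemma glabel_mono (k h : ℕ) : Monotone (glabel k h) :=
  monotone_nat_of_le_succ fun i => by rw [glabel_succ]; omega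

lemma ggap_cast (k h : ℕ) (hk : 1 ≤ k) (hh : 2 ≤ h) (i : ℕ)
    (hi : i + 1 < (2 * k + 1) * (2 * h)) :
    (ggap k h i : ℤ) = 2 * k + 2 * h - gd (gseq k h i) (gseq k h (i + 1)) := by
  obtain ⟨h1, h2⟩ := gseq_spec k h hk hh i (by omega)
  have h3 := gap_pos k h _ (by omega) (by omega) h1 (gseq_ne_last k h i hi h2)
  rw [← gseq_succ] at h3
  unfold ggap
  omega

lemma glabel_radio (k h : ℕ) (hk : 1 ≤ k) (hh : 2 ≤ h) (i j : ℕ) (hij : i < j)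
    (hj : j < (2 * k + 1) * (2 * h)) (hd : 1 ≤ gd (gseq k h i) (gseq k h j)) :
    (2 * k + 2 * h : ℤ) - gd (gseq k h i) (gseq k h j) ≤ (glabel k h j : ℤ) - glabel k h i := by
  obtain ⟨v1, r1⟩ := gseq_spec k h hk hh i (by omega)
  have l1 := gseq_ne_last k h i (by omega) r1
  have g1 := ggap_cast k h hk hh i (by omega)
  have s1 := glabel_succ k h i
  by_cases c1 : j = i + 1
  · subst c1
    omega
  obtain ⟨v2, r2⟩ := gseq_spec k h hk hh (i + 1) (by omega)
  have l2 := gseq_ne_last k h (i + 1) (by omega) r2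
  have g2 := ggap_cast k h hk hh (i + 1) (by omega)
  have s2 := glabel_succ k h (i + 1)
  by_cases c2 : j = i + 1 + 1
  · subst c2
    have t := gap_two k h (gseq k h i) (by omega) (by omega) v1 l1 (by rwa [← gseq_succ])
    rw [← gseq_succ, ← gseq_succ] at t
    omega
  obtain ⟨v3, r3⟩ := gseq_spec k h hk hh (i + 1 + 1) (by omega)
  have l3 := gseq_ne_last k h (i + 1 + 1) (by omega) r3
  have g3 := ggap_cast k h hk hh (i + 1 + 1) (by omega)
  have s3 := glabel_succ k h (i + 1 + 1)
  have t := gap_three k h (gseq k h i) (by omega) (by omega) v1 l1 (by rwa [← gseq_succ])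
    (by rwa [← gseq_succ, ← gseq_succ])
  rw [← gseq_succ, ← gseq_succ, ← gseq_succ] at t
  have hm : glabel k h (i + 1 + 1 + 1) ≤ glabel k h j := glabel_mono k h (by omega)
  omega

/-- Doubled distance to the centre in centred coordinates. -/
def gW (h : ℕ) (p : ℤ × ℤ) : ℤ := 2 * |p.1| + |2 * p.2 - (2 * h - 1)|

lemma glabel_eq (k h : ℕ) (hk : 1 ≤ k) (hh : 2 ≤ h) (i : ℕ) :
    i < (2 * k + 1) * (2 * h) → 2 * (glabel k h i : ℤ) = 2 * i * (2 * k + 2 * h)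
      - 2 * ∑ j ∈ Finset.range (i + 1), gW h (gseq k h j)
      + gW h (gseq k h 0) + gW h (gseq k h i) := by
  induction i with
  | zero =>
    intro _
    simp [glabel]
    ring
  | succ i ih =>
    intro hi
    have h0 := ih (by omega)
    obtain ⟨v1, r1⟩ := gseq_spec k h hk hh i (by omega)
    have l1 := gseq_ne_last k h i (by omega) r1
    have g1 := ggap_cast k h hk hh i (by omega)
    have hw := gnext_W k h _ (by omega) (by omega) v1 l1
    rw [← gseq_succ] at hw
    rw [glabel_succ, Finset.sum_range_succ]
    change _ = gW h (gseq k h i) + gW h (gseq k h (i + 1)) at hw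
    push_cast
    linarith

lemma upper_bound (k h : ℕ) (hk : 1 ≤ k) (hh : 2 ≤ h) :
    ∃ f, IsRadioLabeling (pathGraph (2 * k + 1) □ pathGraph (2 * h)) f ∧
    (labelSpan f : ℤ) ≤ ((2 * k + 1) * (2 * h) - 1 : ℤ) * (2 * k + 2 * h)
      - (2 * (2 * h) * (k * (k + 1)) + (2 * k + 1) * (2 * h * h)) + 1 := by
  obtain ⟨σ, hσ⟩ := exists_order k h hk hh
  have hN : 0 < (2 * k + 1) * (2 * h) := by positivity
  refine ⟨fun u => glabel k h (σ.symm u), ?_, ?_⟩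
  · have key : ∀ u v, σ.symm u < σ.symm v →
        (2 * k + 2 * h : ℤ) - gridDist u v ≤
          (glabel k h (σ.symm v) : ℤ) - glabel k h (σ.symm u) := by
      intro u v huv
      have hu : gcoord k h u = gseq k h (σ.symm u) := by rw [← hσ]; simp
      have hv : gcoord k h v = gseq k h (σ.symm v) := by rw [← hσ]; simp
      have hne : u ≠ v := by rintro rfl; exact lt_irrefl _ huv
      have hd : 1 ≤ gridDist u v := by
        by_contra hcon
        apply hne
        unfold gridDist at hcon
        apply Prod.ext <;> apply Fin.ext <;> omega
      have := glabel_radio k h hk hh (σ.symm u) (σ.symm v) huv (σ.symm v).isLt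
        (by rw [← hu, ← hv, gd_gcoord]; exact hd)
      rw [← hu, ← hv, gd_gcoord] at this
      exact this
    intro u v huv
    rw [grid_diam (by omega) (by omega), grid_dist]
    have hM : ((2 * k + 1 + 2 * h - 2 : ℕ) : ℤ) + 1 = 2 * k + 2 * h := by omega
    rw [hM]
    rcases lt_trichotomy (σ.symm u) (σ.symm v) with hlt | heq | hlt
    · have := key u v hlt
      rw [abs_sub_comm]
      exact this.trans (le_abs_self _)
    · exact absurd (σ.symm.injective heq) huv
    · have := key v u hlt
      have hc : gridDist v u = gridDist u v := by unfold gridDist; omega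
      rw [hc] at this
      exact this.trans (le_abs_self _)
  · have h1 : labelSpan (fun u => glabel k h (σ.symm u)) ≤
        glabel k h ((2 * k + 1) * (2 * h) - 1) := by
      unfold labelSpan
      refine (Nat.sub_le _ _).trans (Finset.sup_le fun u _ => ?_)
      apply glabel_mono
      have := (σ.symm u).isLt
      omega
    have h2 := glabel_eq k h hk hh ((2 * k + 1) * (2 * h) - 1) (by omega)
    have h3 : ∑ j ∈ Finset.range ((2 * k + 1) * (2 * h) - 1 + 1), gW h (gseq k h j)
        = ∑ u, gridW k h u := by
      rw [Nat.sub_add_cancel hN, ← Fin.sum_univ_eq_sum_range (fun j => gW h (gseq k h j)),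
        ← Equiv.sum_comp σ]
      refine Finset.sum_congr rfl fun i _ => ?_
      rw [← hσ]
      rfl
    have h4 : gW h (gseq k h 0) = 1 := by
      simp only [gW, gseq, Function.iterate_zero, id_eq, Int.abs_eq_natAbs]
      omega
    have h5 : gseq k h ((2 * k + 1) * (2 * h) - 1) = (0, (h : ℤ)) := by
      obtain ⟨u, hu⟩ := gcoord_surj k h (0, (h : ℤ)) (by
        simp only [GValid]; omega)
      have e1 : gseq k h (σ.symm u) = (0, (h : ℤ)) := by rw [← hσ]; simpa using hu
      have e2 := (gseq_spec k h hk hh (σ.symm u) (σ.symm u).isLt).2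
      rw [e1, grank_last] at e2
      have e3 : ((σ.symm u : ℕ) : ℤ) + 1 = (((2 * k + 1) * (2 * h) : ℕ) : ℤ) := by
        rw [← e2]; push_cast; ring
      have e4 : (2 * k + 1) * (2 * h) - 1 = (σ.symm u : ℕ) := by omega
      rw [e4, e1]
    have h6 : gW h (gseq k h ((2 * k + 1) * (2 * h) - 1)) = 1 := by
      rw [h5]
      simp only [gW, Int.abs_eq_natAbs]
      omega
    rw [h3, h4, h6, sum_gridW] at h2
    have h7 : (((2 * k + 1) * (2 * h) - 1 : ℕ) : ℤ) = (2 * k + 1) * (2 * h) - 1 := by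
      rw [Nat.cast_sub hN]; push_cast; ring
    rw [h7] at h2
    have h8 : (labelSpan (fun u => glabel k h (σ.symm u)) : ℤ) ≤
        glabel k h ((2 * k + 1) * (2 * h) - 1) := by exact_mod_cast h1
    linarith

lemma formula_cast (k h : ℕ) (hk : 1 ≤ k) (hh : 2 ≤ h) :
    ((((2 * k + 1) * (2 * h) ^ 2 + (2 * h) * (2 * k + 1) ^ 2 - 2 * h) / 2
      - (2 * k + 1) * (2 * h) - (2 * k + 1) + 2 : ℕ) : ℤ) =
    ((2 * k + 1) * (2 * h) - 1 : ℤ) * (2 * k + 2 * h)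
      - (2 * (2 * h) * (k * (k + 1)) + (2 * k + 1) * (2 * h * h)) + 1 := by
  obtain ⟨k, rfl⟩ : ∃ k', k = k' + 1 := ⟨k - 1, by omega⟩
  obtain ⟨h, rfl⟩ : ∃ h', h = h' + 2 := ⟨h - 2, by omega⟩
  have e1 : (2 * (k + 1) + 1) * (2 * (h + 2)) ^ 2 + (2 * (h + 2)) * (2 * (k + 1) + 1) ^ 2
      - 2 * (h + 2) = 2 * (2 * (h + 2) ^ 2 * (2 * (k + 1) + 1)
        + (h + 2) * (4 * (k + 1) ^ 2 + 4 * (k + 1))) := by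
    apply Nat.sub_eq_of_eq_add
    ring
  rw [e1, Nat.mul_div_cancel_left _ (by norm_num)]
  have e2 : (2 * (k + 1) + 1) * (2 * (h + 2)) + (2 * (k + 1) + 1) ≤
      2 * (h + 2) ^ 2 * (2 * (k + 1) + 1) + (h + 2) * (4 * (k + 1) ^ 2 + 4 * (k + 1)) := by
    nlinarith [Nat.zero_le (h * k), Nat.zero_le (h ^ 2 * k), Nat.zero_le (h * k ^ 2)]
  rw [Nat.sub_sub, Nat.cast_add, Nat.cast_sub e2]
  push_cast
  ring

/-- Jiang's theorem, `rn(P_m □ P_n) = (mn² + nm² - n)/2 - mn - m + 2`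
for `m, n > 2` with `m` odd and `n` even. -/
theorem stmt19 (m n : ℕ) (hm : 2 < m) (hn : 2 < n) (hmo : Odd m) (hne : Even n) :
    radioNumber (SimpleGraph.pathGraph m □ SimpleGraph.pathGraph n) =
      (m * n ^ 2 + n * m ^ 2 - n) / 2 - m * n - m + 2 := by
  obtain ⟨k, rfl⟩ := hmo
  obtain ⟨h, rfl⟩ := hne.exists_two_nsmul
  simp only [nsmul_eq_mul, Nat.cast_ofNat] at hn ⊢
  have hk : 1 ≤ k := by omega
  have hh : 2 ≤ h := by omega
  have hform := formula_cast k h hk hh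
  obtain ⟨f, hf, hspan⟩ := upper_bound k h hk hh
  unfold radioNumber
  apply le_antisymm
  · have hmem : labelSpan f ∈ {s | ∃ f, IsRadioLabeling
        (pathGraph (2 * k + 1) □ pathGraph (2 * h)) f ∧ labelSpan f = s} := ⟨f, hf, rfl⟩
    refine (Nat.sInf_le hmem).trans ?_
    rw [← hform] at hspan
    exact_mod_cast hspan
  · refine le_csInf (Set.nonempty_of_mem (x := labelSpan f) ⟨f, hf, rfl⟩) ?_
    rintro s ⟨g, hg, rfl⟩
    have := lower_bound k h (by omega) g hg
    rw [← hform] at this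
    exact_mod_cast this
end
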